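/- (Theorem 4.1, convergence of the free-boundary coefficient as the heat transfer coefficient tends to infinity.) Let β and δ be real constants with β ≥ max(δ, −1−δ), set α = β − δ, and let k, a, γ, u_∞ > 0. For each h₀ > 0 let ξ_R(h₀) be the unique positive root of (k·u_∞/(γ·2^{β+1}·a^{β+δ+2}))·f₁(z, h₀) = z^{β+δ+1}, where f₁(z, h₀) = 1/( (k/(2·a·h₀))·M(α/2 + 1/2, 1/2, z²) + z·M(α/2 + 1, 3/2, z²) ), and let ξ_{D∞} be the unique positive root of (k·u_∞/(γ·2^{β+1}·a^{β+δ+2}))·f(z) = z^{β+δ+1} with f(z) = 1/(z·M(α/2 + 1, 3/2, z²)). Then ξ_R(h₀) → ξ_{D∞} as h₀ → +∞. -/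

import Mathlib

/-- Kummer's confluent hypergeometric function
`M(a,b,z) = ∑ (a)_n / (b)_n · zⁿ/n!`, with `(a)_n` the rising factorial. -/
noncomputable def kummerM (a b z : ℝ) : ℝ :=
  ∑' n : ℕ, ((ascPochhammer ℝ n).eval a / (ascPochhammer ℝ n).eval b) * z ^ n / (n.factorial : ℝ)

theorem ascPochhammer_eval_le_pow_mul {a b : ℝ} (ha : 0 < a) (hb : 0 < b) (n : ℕ) :
    (ascPochhammer ℝ n).eval a ≤ (1 + a / b) ^ n * (ascPochhammer ℝ n).eval b := by
  induction n with
  | zero => simp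
  | succ n ih =>
    rw [ascPochhammer_succ_eval, ascPochhammer_succ_eval, pow_succ]
    have hfactor : a + n ≤ (1 + a / b) * (b + n) := by
      have hexpand : (1 + a / b) * (b + n) = b + n + a + a / b * n := by
        field_simp
        ring
      have : 0 ≤ a / b * n := by positivity
      linarith
    have hpos := ascPochhammer_pos n b hb
    calc _ ≤ (1 + a / b) ^ n * (ascPochhammer ℝ n).eval b * ((1 + a / b) * (b + n)) := by
          gcongr
      _ = _ := by ring

theorem kummerM_coeff_pos {a b : ℝ} (ha : 0 < a) (hb : 0 < b) (n : ℕ) :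
    0 < (ascPochhammer ℝ n).eval a / (ascPochhammer ℝ n).eval b :=
  div_pos (ascPochhammer_pos n a ha) (ascPochhammer_pos n b hb)

theorem summable_kummerM {a b z : ℝ} (ha : 0 < a) (hb : 0 < b) (hz : 0 ≤ z) :
    Summable fun n : ℕ => ((ascPochhammer ℝ n).eval a / (ascPochhammer ℝ n).eval b) *
      z ^ n / (n.factorial : ℝ) := by
  refine Summable.of_nonneg_of_le (fun n => ?_) (fun n => ?_)
    (Real.summable_pow_div_factorial ((1 + a / b) * z))
  · have := kummerM_coeff_pos ha hb n
    positivity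
  · rw [mul_pow]
    gcongr
    rw [div_le_iff₀ (ascPochhammer_pos n b hb)]
    exact ascPochhammer_eval_le_pow_mul ha hb n

theorem kummerM_pos {a b z : ℝ} (ha : 0 < a) (hb : 0 < b) (hz : 0 ≤ z) : 0 < kummerM a b z := by
  refine (summable_kummerM ha hb hz).tsum_pos (fun n => ?_) 0 (by simp)
  have := kummerM_coeff_pos ha hb n
  positivity

theorem kummerM_le_kummerM {a b x y : ℝ} (ha : 0 < a) (hb : 0 < b) (hx : 0 ≤ x) (hxy : x ≤ y) :
    kummerM a b x ≤ kummerM a b y := by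
  refine (summable_kummerM ha hb hx).tsum_le_tsum (fun n => ?_)
    (summable_kummerM ha hb (hx.trans hxy))
  have := kummerM_coeff_pos ha hb n
  gcongr

/-- Theorem 4.1 (coefficient convergence): the positive root `ξ_R(h₀)` of the Robin
equation converges, as the heat transfer coefficient `h₀ → +∞`, to the positive root
`ξ_{D∞}` of the Dirichlet equation. -/
theorem stmt18 (β δ k a γ uinf : ℝ) (hβ : β ≥ max δ (-1 - δ))
    (hk : 0 < k) (ha : 0 < a) (hγ : 0 < γ) (huinf : 0 < uinf)
    (α : ℝ) (hα : α = β - δ)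
    (ξR : ℝ → ℝ)
    (hξR : ∀ h₀ : ℝ, 0 < h₀ → 0 < ξR h₀ ∧
      (k * uinf / (γ * (2:ℝ) ^ (β + 1) * a ^ (β + δ + 2))) *
        (1 / ((k / (2 * a * h₀)) * kummerM (α/2 + 1/2) (1/2) ((ξR h₀)^2) +
          ξR h₀ * kummerM (α/2 + 1) (3/2) ((ξR h₀)^2))) = (ξR h₀) ^ (β + δ + 1))
    (ξD : ℝ) (hξDpos : 0 < ξD)
    (hξD : (k * uinf / (γ * (2:ℝ) ^ (β + 1) * a ^ (β + δ + 2))) *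
      (1 / (ξD * kummerM (α/2 + 1) (3/2) (ξD^2))) = ξD ^ (β + δ + 1)) :
    Filter.Tendsto ξR Filter.atTop (nhds ξD) := by
  have hα0 : 0 ≤ α := by linarith [(le_max_left δ (-1 - δ)).trans hβ]
  have hp : 0 ≤ β + δ + 1 := by linarith [(le_max_right δ (-1 - δ)).trans hβ]
  generalize β + δ + 1 = p at *
  have hc : 0 < k * uinf / (γ * (2:ℝ) ^ (β + 1) * a ^ (β + δ + 2)) := by positivity
  generalize k * uinf / (γ * (2:ℝ) ^ (β + 1) * a ^ (β + δ + 2)) = c at *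
  have hA0 : 0 < α / 2 + 1 / 2 := by linarith
  have hB0 : 0 < α / 2 + 1 := by linarith
  set A : ℝ → ℝ := fun x => kummerM (α/2 + 1/2) (1/2) (x ^ 2)
  set B : ℝ → ℝ := fun x => kummerM (α/2 + 1) (3/2) (x ^ 2)
  have hApos (x : ℝ) : 0 < A x := kummerM_pos hA0 (by norm_num) (sq_nonneg x)
  have hBpos (x : ℝ) : 0 < B x := kummerM_pos hB0 (by norm_num) (sq_nonneg x)
  have hAmono {x y : ℝ} (hx : 0 < x) (hxy : x ≤ y) : A x ≤ A y :=
    kummerM_le_kummerM hA0 (by norm_num) (sq_nonneg x) (by gcongr)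
  have hBmono {x y : ℝ} (hx : 0 < x) (hxy : x ≤ y) : B x ≤ B y :=
    kummerM_le_kummerM hB0 (by norm_num) (sq_nonneg x) (by gcongr)
  have hD : c = ξD ^ p * (ξD * B ξD) := by
    have h := hξD
    change c * (1 / (ξD * B ξD)) = ξD ^ p at h
    rwa [mul_one_div, div_eq_iff (mul_pos hξDpos (hBpos ξD)).ne'] at h
  have hR (h : ℝ) (hh : 0 < h) :
      c = ξR h ^ p * (k / (2 * a * h) * A (ξR h) + ξR h * B (ξR h)) := by
    obtain ⟨hpos, heq⟩ := hξR h hh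
    have hne : k / (2 * a * h) * A (ξR h) + ξR h * B (ξR h) ≠ 0 := by
      have := hApos (ξR h)
      have := hBpos (ξR h)
      positivity
    change c * (1 / (k / (2 * a * h) * A (ξR h) + ξR h * B (ξR h))) = _ at heq
    rwa [mul_one_div, div_eq_iff hne] at heq
  refine tendsto_order.2 ⟨fun y hy => ?_, fun y hy => ?_⟩
  · rcases le_or_gt y 0 with hy0 | hy0
    · filter_upwards [Filter.eventually_gt_atTop 0] with h hh
      exact hy0.trans_lt (hξR h hh).1
    have hlt : y ^ p * (0 * A y + y * B y) < c := by
      rw [zero_mul, zero_add, hD]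
      have := hBpos y
      calc y ^ p * (y * B y) < y ^ p * (ξD * B y) := by gcongr
        _ ≤ ξD ^ p * (ξD * B ξD) := by
          have := hBmono hy0 hy.le
          gcongr
    have hκ : Filter.Tendsto (fun h : ℝ => k / (2 * a * h)) Filter.atTop (nhds 0) :=
      (Filter.tendsto_id.const_mul_atTop (by positivity : 0 < 2 * a)).const_div_atTop k
    have hlim := ((hκ.mul_const (A y)).add_const (y * B y)).const_mul (y ^ p)
    filter_upwards [hlim.eventually_lt_const hlt, Filter.eventually_gt_atTop 0] with h hh h0
    by_contra! hle
    have hpos := (hξR h h0).1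
    refine absurd hh (not_lt.2 ?_)
    rw [hR h h0]
    have := hApos (ξR h)
    have := hBpos (ξR h)
    have := hAmono hpos hle
    have := hBmono hpos hle
    gcongr
  · filter_upwards [Filter.eventually_gt_atTop 0] with h h0
    refine lt_of_le_of_lt ?_ hy
    by_contra! hlt
    have hpos := (hξR h h0).1
    have hge : c ≤ ξR h ^ p * (ξR h * B (ξR h)) := by
      rw [hD]
      have := hBpos ξD
      have := hBmono hξDpos hlt.le
      gcongr
    have hextra : 0 < ξR h ^ p * (k / (2 * a * h) * A (ξR h)) := by
      have := hApos (ξR h)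
      positivity
    have := hR h h0
    rw [mul_add] at this
    linarith
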